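/- arXiv:1008.0271 — 3 statements merged into one kernel-verified Lean document; each statement's English description precedes it below -/
import Mathlib

section
/- For every integer s ≥ 2 and every natural number k, the k-th moment of the density π_s equals the Fuss–Catalan number: ∫_0^K x^k π_s(x) dx = (1/(sk+1)) · binomial((s+1)k, k). -/
open MeasureTheory Real

noncomputable def eulerBeta (a b : ℝ) : ℝ := Real.Gamma a * Real.Gamma b / Real.Gamma (a + b)

noncomputable def Kc (s : ℕ) : ℝ := ((s : ℝ) + 1) ^ (s + 1) / (s : ℝ) ^ s

noncomputable def tauProd {s : ℕ} (t : Fin s → ℝ) : ℝ := ∏ i, t i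

def cube (s : ℕ) : Set (Fin s → ℝ) := Set.univ.pi fun _ => Set.Icc (0 : ℝ) 1

noncomputable def Cnorm (s : ℕ) : ℝ :=
  1 / (eulerBeta (1 / ((s : ℝ) + 1)) (((s : ℝ) - 1) / (2 * (s : ℝ) + 2)) *
      ∏ j ∈ Finset.Icc 2 s,
        eulerBeta ((j : ℝ) / ((s : ℝ) + 1)) ((j : ℝ) / ((s : ℝ) * ((s : ℝ) + 1))))

noncomputable def Fdens (s : ℕ) (t : Fin s → ℝ) : ℝ :=
  Cnorm s * ∏ i : Fin s,
    if (i : ℕ) = 0 then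
      t i ^ (1 / ((s : ℝ) + 1) - 1) * (1 - t i) ^ (((s : ℝ) - 1) / (2 * (s : ℝ) + 2) - 1)
    else
      t i ^ ((((i : ℕ) : ℝ) + 1) / ((s : ℝ) + 1) - 1) *
        (1 - t i) ^ ((((i : ℕ) : ℝ) + 1) / ((s : ℝ) * ((s : ℝ) + 1)) - 1)

noncomputable def piDens (s : ℕ) (x : ℝ) : ℝ :=
  (1 / eulerBeta (1 / 2) (1 / 2 + 1 / (s : ℝ))) *
    ∫ t in cube s,
      if x ≤ tauProd t * Kc s then
        (tauProd t * Kc s - x) ^ (1 / (s : ℝ) - 1 / 2) * x ^ (-(1 : ℝ) / 2) *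
          (tauProd t * Kc s) ^ (-(1 : ℝ) / (s : ℝ)) * Fdens s t
      else 0


noncomputable def riseP (a : ℝ) (k : ℕ) : ℝ := ∏ m ∈ Finset.range k, (a + m)

lemma riseP_pos {a : ℝ} (ha : 0 < a) (k : ℕ) : 0 < riseP a k :=
  Finset.prod_pos fun m _ => by positivity

lemma riseP_succ (a : ℝ) (k : ℕ) : riseP a (k + 1) = riseP a k * (a + k) := by
  simp [riseP, Finset.prod_range_succ]

lemma riseP_shift (a : ℝ) (k : ℕ) : riseP (a + 1) k * a = riseP a k * (a + k) := by
  rw [← riseP_succ, riseP, riseP, Finset.prod_range_succ']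
  simp only [Nat.cast_add, Nat.cast_one, Nat.cast_zero, add_zero]
  congr 1
  exact Finset.prod_congr rfl fun m _ => by ring

lemma Gamma_add_nat_rise {a : ℝ} (ha : 0 < a) (k : ℕ) :
    Real.Gamma (a + k) = Real.Gamma a * riseP a k := by
  induction k with
  | zero => simp [riseP]
  | succ k ih =>
    rw [riseP_succ, Nat.cast_succ, ← add_assoc, Real.Gamma_add_one (by positivity), ih]
    ring

lemma eulerBeta_pos {a b : ℝ} (ha : 0 < a) (hb : 0 < b) : 0 < eulerBeta a b :=
  div_pos (mul_pos (Real.Gamma_pos_of_pos ha) (Real.Gamma_pos_of_pos hb))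
    (Real.Gamma_pos_of_pos (add_pos ha hb))

lemma eulerBeta_add_nat {a b : ℝ} (ha : 0 < a) (hb : 0 < b) (k : ℕ) :
    eulerBeta (a + k) b = eulerBeta a b * (riseP a k / riseP (a + b) k) := by
  have h1 := riseP_pos (add_pos ha hb) k
  have h2 := Real.Gamma_pos_of_pos (add_pos ha hb)
  rw [eulerBeta, eulerBeta, Gamma_add_nat_rise ha, add_right_comm,
    Gamma_add_nat_rise (add_pos ha hb)]
  field_simp

lemma rise_mult (n : ℕ) (hn : 0 < n) (k : ℕ) :
    (∏ i ∈ Finset.range n, riseP (((i : ℝ) + 1) / n) k) * (n : ℝ) ^ (n * k)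
      = ((n * k).factorial : ℝ) := by
  have hn' : (n : ℝ) ≠ 0 := by positivity
  induction k with
  | zero => simp [riseP]
  | succ k ih =>
    simp only [riseP_succ, Finset.prod_mul_distrib]
    rw [Nat.mul_succ, pow_add, ← Nat.factorial_mul_ascFactorial, Nat.cast_mul, ← ih,
      Nat.ascFactorial_eq_prod_range]
    have : ((∏ i ∈ Finset.range n, (n * k + 1 + i) : ℕ) : ℝ)
        = (∏ i ∈ Finset.range n, (((i : ℝ) + 1) / n + k)) * (n : ℝ) ^ n := by
      conv_rhs => rw [← Finset.card_range n, ← Finset.prod_const, Finset.card_range]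
      rw [← Finset.prod_mul_distrib]
      push_cast
      refine Finset.prod_congr rfl fun i _ => ?_
      field_simp
      ring
    rw [this]
    ring

lemma beta_unit {u v : ℝ} (hu : 0 < u) (hv : 0 < v) :
    IntervalIntegrable (fun x : ℝ => x ^ (u - 1) * (1 - x) ^ (v - 1)) volume 0 1 ∧
      ∫ x in (0:ℝ)..1, x ^ (u - 1) * (1 - x) ^ (v - 1) = eulerBeta u v := by
  have hc := Complex.betaIntegral_convergent (u := u) (v := v) (by simpa) (by simpa)
  rw [intervalIntegrable_iff_integrableOn_Ioc_of_le (by simp)] at hc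
  have hE : ∀ x ∈ Set.Ioc (0:ℝ) 1, RCLike.re ((x : ℂ) ^ ((u : ℂ) - 1) * (1 - (x : ℂ)) ^ ((v : ℂ) - 1))
      = x ^ (u - 1) * (1 - x) ^ (v - 1) := by
    intro x ⟨hx1, hx2⟩
    norm_cast
    rw [← Complex.ofReal_cpow hx1.le, ← Complex.ofReal_cpow (by linarith), RCLike.re_to_complex,
        Complex.re_mul_ofReal, Complex.ofReal_re]
  constructor
  · rw [intervalIntegrable_iff_integrableOn_Ioc_of_le (by simp)]
    exact (MeasureTheory.integrableOn_congr_fun hE measurableSet_Ioc).1 hc.re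
  · have : eulerBeta u v = _ := ProbabilityTheory.beta_eq_betaIntegralReal u v hu hv
    rw [this, Complex.betaIntegral, intervalIntegral.integral_of_le (by norm_num),
      intervalIntegral.integral_of_le (by norm_num), ← RCLike.re_to_complex, ← integral_re hc]
    exact (setIntegral_congr_fun measurableSet_Ioc hE).symm

lemma beta_scaled {u v y : ℝ} (hu : 0 < u) (hv : 0 < v) (hy : 0 < y) :
    IntervalIntegrable (fun x : ℝ => x ^ (u - 1) * (y - x) ^ (v - 1)) volume 0 y ∧
      ∫ x in (0:ℝ)..y, x ^ (u - 1) * (y - x) ^ (v - 1) = y ^ (u + v - 1) * eulerBeta u v := by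
  obtain ⟨h1, h2⟩ := beta_unit hu hv
  have hE : ∀ x ∈ Set.Ioc (0:ℝ) 1, (y * x) ^ (u - 1) * (y - y * x) ^ (v - 1)
      = y ^ (u + v - 2) * (x ^ (u - 1) * (1 - x) ^ (v - 1)) := by
    intro x ⟨hx1, hx2⟩
    rw [show y - y * x = y * (1 - x) by ring, Real.mul_rpow hy.le hx1.le,
      Real.mul_rpow hy.le (by linarith), show u + v - 2 = (u - 1) + (v - 1) by ring,
      Real.rpow_add hy]
    ring
  constructor
  · have := (IntervalIntegrable.comp_mul_left_iff
      (f := fun x : ℝ => x ^ (u - 1) * (y - x) ^ (v - 1)) (a := 0) (b := y) hy.ne').1 (by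
        rw [zero_div, div_self hy.ne']
        refine (h1.const_mul (y ^ (u + v - 2))).congr ?_
        rw [Set.uIoc_of_le zero_le_one]
        intro x hx
        exact (hE x hx).symm)
    exact this
  · have := intervalIntegral.integral_comp_mul_left
      (fun x : ℝ => x ^ (u - 1) * (y - x) ^ (v - 1)) (a := 0) (b := 1) hy.ne'
    rw [mul_zero, mul_one] at this
    have h3 : ∫ x in (0:ℝ)..1, (y * x) ^ (u - 1) * (y - y * x) ^ (v - 1)
      = y ^ (u + v - 2) * eulerBeta u v := by
      rw [← h2, ← intervalIntegral.integral_const_mul]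
      exact intervalIntegral.integral_congr_Ioo_of_le zero_le_one
        fun x hx => hE x (Set.Ioo_subset_Ioc_self hx)
    rw [h3, smul_eq_mul] at this
    rw [show u + v - 1 = (u + v - 2) + 1 by ring, Real.rpow_add_one hy.ne']
    field_simp at this
    linarith

noncomputable def Apar (s i : ℕ) : ℝ := ((i : ℝ) + 1) / ((s : ℝ) + 1)
noncomputable def Bpar (s i : ℕ) : ℝ :=
  if i = 0 then ((s : ℝ) - 1) / (2 * (s : ℝ) + 2) else ((i : ℝ) + 1) / ((s : ℝ) * ((s : ℝ) + 1))

lemma Apar_pos (s i : ℕ) : 0 < Apar s i := by unfold Apar; positivity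
lemma Bpar_pos {s : ℕ} (hs : 2 ≤ s) (i : ℕ) : 0 < Bpar s i := by
  have : (2:ℝ) ≤ s := by exact_mod_cast hs
  unfold Bpar
  split_ifs
  · exact div_pos (by linarith) (by linarith)
  · positivity

lemma Fdens_eq (s : ℕ) (t : Fin s → ℝ) :
    Fdens s t = Cnorm s * ∏ i : Fin s, (t i ^ (Apar s i - 1) * (1 - t i) ^ (Bpar s i - 1)) := by
  unfold Fdens
  congr 1
  refine Finset.prod_congr rfl fun i _ => ?_
  unfold Apar Bpar
  split_ifs with h
  · simp [h]
  · rfl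

lemma Cnorm_eq {s : ℕ} (hs : 2 ≤ s) :
    Cnorm s = 1 / ∏ i ∈ Finset.range s, eulerBeta (Apar s i) (Bpar s i) := by
  unfold Cnorm
  congr 1
  obtain ⟨n, rfl⟩ : ∃ n, s = n + 1 := ⟨s - 1, by omega⟩
  rw [Finset.prod_range_succ', mul_comm]
  congr 1
  · rw [← Finset.Ico_add_one_right_eq_Icc, Finset.prod_Ico_eq_prod_range]
    refine Finset.prod_congr (by congr 1) fun i _ => ?_
    unfold Apar Bpar
    rw [if_neg (by omega)]
    push_cast
    congr 2 <;> ring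
  · simp [Apar, Bpar]

lemma Cnorm_pos {s : ℕ} (hs : 2 ≤ s) : 0 < Cnorm s := by
  rw [Cnorm_eq hs]
  exact one_div_pos.2 (Finset.prod_pos fun i _ => eulerBeta_pos (Apar_pos s i) (Bpar_pos hs i))

lemma AB_sum {s : ℕ} (hs : 2 ≤ s) (i : ℕ) :
    Apar s i + Bpar s i = if i = 0 then 1 / 2 else ((i : ℝ) + 1) / s := by
  have : (2:ℝ) ≤ s := by exact_mod_cast hs
  unfold Apar Bpar
  split_ifs with h
  · subst h
    have : (s : ℝ) + 1 ≠ 0 := by positivity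
    push_cast
    field_simp
    ring
  · field_simp
    try ring

lemma combi {s : ℕ} (hs : 2 ≤ s) (k : ℕ) :
    riseP (1/2) k / riseP (1 / (s:ℝ) + 1) k * (Kc s ^ k *
      ∏ i ∈ Finset.range s, (riseP (Apar s i) k / riseP (Apar s i + Bpar s i) k))
    = (1 / ((s : ℝ) * k + 1)) * (((s + 1) * k).choose k) := by
  have hs0 : (0:ℝ) < s := by positivity
  have e1 := rise_mult (s + 1) (by omega) k
  have e2 := rise_mult s (by omega) k
  rw [Finset.prod_range_succ] at e1
  have e3 := rise_mult 1 (by omega) k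
  simp only [Finset.prod_range_one, Nat.cast_zero, zero_add, Nat.cast_one, div_one, one_pow, mul_one, one_mul] at e3
  push_cast at e1
  rw [div_self (by positivity), e3] at e1
  have e4 := riseP_shift (1 / (s:ℝ)) k
  have e5 : (∏ i ∈ Finset.range s, riseP (Apar s i + Bpar s i) k) * riseP (1 / (s:ℝ)) k
      = riseP (1/2) k * ∏ i ∈ Finset.range s, riseP (((i : ℝ) + 1) / s) k := by
    simp only [AB_sum hs]
    obtain ⟨n, rfl⟩ : ∃ n, s = n + 1 := ⟨s - 1, by omega⟩
    rw [Finset.prod_range_succ', Finset.prod_range_succ']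
    simp
    ring
  have e6 : ((((s + 1) * k).choose k : ℕ) : ℝ) * k.factorial * (s * k).factorial
      = (((s + 1) * k).factorial : ℕ) := by
    have := Nat.choose_mul_factorial_mul_factorial (n := (s+1)*k) (k := k) (by nlinarith)
    rw [show (s + 1) * k - k = s * k by rw [Nat.succ_mul]; omega] at this
    exact_mod_cast this
  rw [Finset.prod_div_distrib]
  change _ / _ * (_ * ((∏ i ∈ Finset.range s, riseP (((i : ℝ) + 1) / ((s : ℝ) + 1)) k) / _)) = _
  have p1 : 0 < riseP (1/2) k := riseP_pos (by norm_num) k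
  have p2 : 0 < riseP (1 / (s:ℝ)) k := riseP_pos (by positivity) k
  have p3 : 0 < riseP (1 / (s:ℝ) + 1) k := riseP_pos (by positivity) k
  have p4 : 0 < ∏ i ∈ Finset.range s, riseP (Apar s i + Bpar s i) k :=
    Finset.prod_pos fun i _ => riseP_pos (add_pos (Apar_pos s i) (Bpar_pos hs i)) k
  have p5 : 0 < ∏ i ∈ Finset.range s, riseP (((i : ℝ) + 1) / s) k :=
    Finset.prod_pos fun i _ => riseP_pos (by positivity) k
  have hK : Kc s ^ k = ((s:ℝ) + 1) ^ ((s + 1) * k) / (s:ℝ) ^ (s * k) := by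
    rw [Kc, div_pow, pow_mul, pow_mul]
  rw [hK]
  generalize (∏ i ∈ Finset.range s, riseP (((i : ℝ) + 1) / ((s : ℝ) + 1)) k) = N at *
  generalize (∏ i ∈ Finset.range s, riseP (Apar s i + Bpar s i) k) = D at *
  generalize (∏ i ∈ Finset.range s, riseP (((i : ℝ) + 1) / s) k) = E at *
  generalize riseP (1/2) k = H at *
  generalize riseP (1 / (s:ℝ)) k = Q at *
  generalize riseP (1 / (s:ℝ) + 1) k = R at *
  have hf : (0:ℝ) < k.factorial := by positivity
  have hsk : (0:ℝ) < (s:ℝ) ^ (s * k) := by positivity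
  have hsk1 : (0:ℝ) < ((s:ℝ)+1) ^ ((s+1) * k) := by positivity
  generalize ((s:ℝ)+1) ^ ((s+1) * k) = U at *
  generalize (s:ℝ) ^ (s * k) = V at *
  have hR : R = Q * (s * k + 1) := by field_simp at e4; linarith
  have hH : H = D * Q / E := by field_simp; linarith
  have hC : ((((s + 1) * k).choose k : ℕ) : ℝ) = N * U / (E * V) := by
    rw [← e1, ← e2] at e6
    field_simp
    have : (k.factorial : ℝ) ≠ 0 := hf.ne'
    apply mul_right_cancel₀ this
    linarith
  rw [hC, hR, hH]
  field_simp

lemma cube_measure (s : ℕ) : (volume : Measure (Fin s → ℝ)).restrict (cube s)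
    = Measure.pi fun _ : Fin s => (volume : Measure ℝ).restrict (Set.Ioc 0 1) := by
  rw [cube, volume_pi, Measure.restrict_pi_pi]
  congr 1
  funext i
  exact (Measure.restrict_congr_set Ioc_ae_eq_Icc).symm

lemma cube_ae (s : ℕ) : ∀ᵐ t ∂((volume : Measure (Fin s → ℝ)).restrict (cube s)),
    ∀ i, t i ∈ Set.Ioc (0:ℝ) 1 := by
  rw [cube_measure, ← Measure.restrict_pi_pi]
  filter_upwards [ae_restrict_mem (MeasurableSet.univ_pi fun _ => measurableSet_Ioc)] with t ht i
  exact ht i trivial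

lemma outer {s : ℕ} (hs : 2 ≤ s) (k : ℕ) :
    Integrable (fun t : Fin s → ℝ => (tauProd t * Kc s) ^ k * Fdens s t)
      (volume.restrict (cube s)) ∧
    ∫ t in cube s, (tauProd t * Kc s) ^ k * Fdens s t =
      Kc s ^ k * ∏ i ∈ Finset.range s, (riseP (Apar s i) k / riseP (Apar s i + Bpar s i) k) := by
  have hE : (fun t : Fin s → ℝ => (tauProd t * Kc s) ^ k * Fdens s t)
      =ᵐ[volume.restrict (cube s)] fun t => (Kc s ^ k * Cnorm s) *
        ∏ i : Fin s, (t i ^ ((Apar s i + k) - 1) * (1 - t i) ^ (Bpar s i - 1)) := by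
    filter_upwards [cube_ae s] with t ht
    rw [Fdens_eq, tauProd, mul_pow, ← Finset.prod_pow]
    have : ∀ i : Fin s, t i ^ ((Apar s i + k) - 1) * (1 - t i) ^ (Bpar s i - 1)
        = t i ^ k * (t i ^ (Apar s i - 1) * (1 - t i) ^ (Bpar s i - 1)) := by
      intro i
      rw [add_sub_right_comm, Real.rpow_add_natCast (ht i).1.ne']
      ring
    have h2 := Finset.prod_congr (rfl : (Finset.univ : Finset (Fin s)) = Finset.univ)
      fun i _ => this i
    rw [Finset.prod_mul_distrib (f := fun i => t i ^ k)] at h2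
    rw [h2, mul_mul_mul_comm, mul_mul_mul_comm, mul_comm (∏ i, t i ^ k)]
    simp only [mul_assoc]
    congr 1
    rw [mul_left_comm]
  have hb : ∀ i : Fin s, _ := fun i : Fin s =>
    beta_unit (u := Apar s i + k) (v := Bpar s i)
      (add_pos_of_pos_of_nonneg (Apar_pos s i) (Nat.cast_nonneg k)) (Bpar_pos hs i)
  rw [integrable_congr hE, integral_congr_ae hE, integral_const_mul, cube_measure]
  constructor
  · refine Integrable.const_mul ?_ _
    refine Integrable.fintype_prod
      (f := fun (i : Fin s) (x : ℝ) => x ^ ((Apar s i + k) - 1) * (1 - x) ^ (Bpar s i - 1)) fun i => ?_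
    exact (intervalIntegrable_iff_integrableOn_Ioc_of_le (by simp)).1 (hb i).1
  · rw [integral_fintype_prod_eq_prod
      (f := fun (i : Fin s) (x : ℝ) => x ^ ((Apar s i + k) - 1) * (1 - x) ^ (Bpar s i - 1))]
    have : ∀ i : Fin s, ∫ x in Set.Ioc (0:ℝ) 1, x ^ ((Apar s i + k) - 1) * (1 - x) ^ (Bpar s i - 1)
      = eulerBeta (Apar s i) (Bpar s i) * (riseP (Apar s i) k / riseP (Apar s i + Bpar s i) k) := by
      intro i
      rw [← intervalIntegral.integral_of_le zero_le_one, (hb i).2,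
        eulerBeta_add_nat (Apar_pos s i) (Bpar_pos hs i)]
    simp only [this]
    rw [Finset.prod_mul_distrib, Cnorm_eq hs,
      Fin.prod_univ_eq_prod_range (fun i => eulerBeta (Apar s i) (Bpar s i)),
      Fin.prod_univ_eq_prod_range (fun i => (riseP (Apar s i) k / riseP (Apar s i + Bpar s i) k))]
    have : 0 < ∏ i ∈ Finset.range s, eulerBeta (Apar s i) (Bpar s i) :=
      Finset.prod_pos fun i _ => eulerBeta_pos (Apar_pos s i) (Bpar_pos hs i)
    field_simp

lemma Kc_pos {s : ℕ} (hs : 2 ≤ s) : 0 < Kc s := by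
  have : (0:ℝ) < s := by positivity
  unfold Kc; positivity

noncomputable def kern (s k : ℕ) (x : ℝ) (t : Fin s → ℝ) : ℝ :=
  x ^ k * (if x ≤ tauProd t * Kc s then
        (tauProd t * Kc s - x) ^ (1 / (s : ℝ) - 1 / 2) * x ^ (-(1 : ℝ) / 2) *
          (tauProd t * Kc s) ^ (-(1 : ℝ) / (s : ℝ)) * Fdens s t
      else 0)

lemma kern_meas (s k : ℕ) : Measurable (Function.uncurry (kern s k)) := by
  have hT : Measurable (fun t : Fin s → ℝ => tauProd t) := by unfold tauProd; fun_prop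
  have hF : Measurable (fun t : Fin s → ℝ => Fdens s t) := by
    simp only [Fdens_eq]; fun_prop
  unfold kern Function.uncurry
  refine Measurable.mul (by fun_prop) (Measurable.ite (measurableSet_le (by fun_prop) (by fun_prop)) ?_ (by fun_prop))
  fun_prop

lemma inner_int {s : ℕ} (hs : 2 ≤ s) (k : ℕ) {t : Fin s → ℝ}
    (ht : ∀ i, t i ∈ Set.Ioc (0:ℝ) 1) :
    (∀ x ∈ Set.Ioc 0 (Kc s), 0 ≤ kern s k x t) ∧
    Integrable (fun x => kern s k x t) (volume.restrict (Set.Ioc 0 (Kc s))) ∧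
    ∫ x in Set.Ioc 0 (Kc s), kern s k x t =
      eulerBeta (1/2 + k) (1/2 + 1/(s:ℝ)) * ((tauProd t * Kc s) ^ k * Fdens s t) := by
  have hs0 : (0:ℝ) < s := by positivity
  have hK := Kc_pos hs
  have hF : 0 ≤ Fdens s t := by
    rw [Fdens_eq]
    refine mul_nonneg (Cnorm_pos hs).le (Finset.prod_nonneg fun i _ => mul_nonneg ?_ ?_)
    · exact Real.rpow_nonneg (ht i).1.le _
    · exact Real.rpow_nonneg (by linarith [(ht i).2]) _
  have hτ : 0 < tauProd t := Finset.prod_pos fun i _ => (ht i).1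
  have hτ1 : tauProd t ≤ 1 := Finset.prod_le_one (fun i _ => (ht i).1.le) fun i _ => (ht i).2
  unfold kern
  have hy : 0 < tauProd t * Kc s := by positivity
  have hyK : tauProd t * Kc s ≤ Kc s := by nlinarith
  generalize tauProd t * Kc s = y at *
  generalize Fdens s t = F at *
  obtain ⟨h1, h2⟩ := beta_scaled (u := 1/2 + k) (v := 1/2 + 1/(s:ℝ)) (y := y)
    (by positivity) (by positivity) hy
  have hE : Set.EqOn (fun x : ℝ => x ^ k * (if x ≤ y then
        (y - x) ^ (1 / (s : ℝ) - 1 / 2) * x ^ (-(1 : ℝ) / 2) * y ^ (-(1 : ℝ) / (s : ℝ)) * F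
      else 0)) ((Set.Ioc 0 y).indicator fun x =>
      (y ^ (-(1 : ℝ) / (s : ℝ)) * F) *
        (x ^ ((1/2 + k : ℝ) - 1) * (y - x) ^ ((1/2 + 1/(s:ℝ)) - 1))) (Set.Ioc 0 (Kc s)) := by
    intro x hx
    simp only [Set.indicator, Set.mem_Ioc, hx.1, true_and]
    split_ifs with h
    · rw [show (1/2 + k : ℝ) - 1 = -1/2 + k by ring, Real.rpow_add_natCast hx.1.ne',
        show (1/2 + 1/(s:ℝ)) - 1 = 1 / (s:ℝ) - 1/2 by ring]
      ring
    · simp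
  refine ⟨?_, ?_, ?_⟩
  · intro x hx
    refine mul_nonneg (pow_nonneg hx.1.le _) ?_
    split_ifs with h
    · have := Real.rpow_nonneg (sub_nonneg.2 h) (1 / (s : ℝ) - 1 / 2)
      have := Real.rpow_nonneg hx.1.le (-(1 : ℝ) / 2)
      positivity
    · exact le_rfl
  · refine (MeasureTheory.integrableOn_congr_fun hE measurableSet_Ioc).2 ?_
    refine Integrable.mono_measure ?_ Measure.restrict_le_self
    rw [integrable_indicator_iff measurableSet_Ioc]
    exact ((intervalIntegrable_iff_integrableOn_Ioc_of_le hy.le).1 h1).const_mul _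
  · rw [setIntegral_congr_fun measurableSet_Ioc hE, setIntegral_indicator measurableSet_Ioc,
      Set.inter_eq_self_of_subset_right (Set.Ioc_subset_Ioc_right hyK), integral_const_mul,
      ← intervalIntegral.integral_of_le hy.le, h2,
      show (1/2 + k + (1/2 + 1/(s:ℝ)) - 1 : ℝ) = 1 / (s:ℝ) + k by ring,
      Real.rpow_add_natCast hy.ne', neg_div, Real.rpow_neg hy.le]
    have := Real.rpow_pos_of_pos hy (1 / (s:ℝ))
    field_simp

/-- For every integer `s ≥ 2` and every natural number `k`, the `k`-th moment
of the density `π_s` equals the Fuss–Catalan number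
`m_k = (1/(sk+1)) · binomial((s+1)k, k)`. -/
theorem moments_of_piDens_eq_fussCatalan (s : ℕ) (hs : 2 ≤ s) (k : ℕ) :
    ∫ x in (0 : ℝ)..(Kc s), x ^ k * piDens s x =
      (1 / ((s : ℝ) * k + 1)) * (((s + 1) * k).choose k) := by
  have hs0 : (0:ℝ) < s := by positivity
  have hB : 0 < eulerBeta (1 / 2) (1 / 2 + 1 / (s : ℝ)) := eulerBeta_pos (by positivity) (by positivity)
  obtain ⟨o1, o2⟩ := outer hs k
  have hint : Integrable (Function.uncurry (kern s k))
      ((volume.restrict (Set.Ioc 0 (Kc s))).prod (volume.restrict (cube s))) := by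
    rw [integrable_prod_iff' (kern_meas s k).aestronglyMeasurable]
    constructor
    · filter_upwards [cube_ae s] with t ht
      exact (inner_int hs k ht).2.1
    · refine (o1.const_mul (eulerBeta (1/2 + k) (1/2 + 1/(s:ℝ)))).congr ?_
      filter_upwards [cube_ae s] with t ht
      obtain ⟨h1, h2, h3⟩ := inner_int hs k ht
      rw [← h3]
      refine setIntegral_congr_fun measurableSet_Ioc fun x hx => ?_
      exact (Real.norm_of_nonneg (h1 x hx)).symm
  have hrew : ∀ x, x ^ k * piDens s x = (1 / eulerBeta (1 / 2) (1 / 2 + 1 / (s : ℝ))) *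
      ∫ t in cube s, kern s k x t := by
    intro x
    unfold piDens kern
    rw [integral_const_mul]
    ring
  simp only [hrew]
  rw [intervalIntegral.integral_of_le (Kc_pos hs).le, integral_const_mul,
    integral_integral_swap hint]
  have : ∫ t in cube s, ∫ x in Set.Ioc 0 (Kc s), kern s k x t =
      ∫ t in cube s, eulerBeta (1/2 + k) (1/2 + 1/(s:ℝ)) * ((tauProd t * Kc s) ^ k * Fdens s t) := by
    refine integral_congr_ae ?_
    filter_upwards [cube_ae s] with t ht
    exact (inner_int hs k ht).2.2
  rw [this, integral_const_mul, o2, ← combi hs k,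
    eulerBeta_add_nat (by positivity) (by positivity),
    show (1/2 + (1/2 + 1/(s:ℝ)) : ℝ) = 1/(s:ℝ) + 1 by ring]
  generalize eulerBeta (1 / 2) (1 / 2 + 1 / (s : ℝ)) = W at *
  rw [one_div, mul_assoc, inv_mul_cancel_left₀ hB.ne']
end

section
/- For every natural number k, ∫_0^4 x^k · (1/(2π)) · √(4/x − 1) dx = (1/(k+1)) · binomial(2k, k); that is, the moments of the density π_1(x) = (1/(2π))√(4x^{−1} − 1) on (0,4] are the Catalan numbers. -/
open MeasureTheory Real

lemma aux_sin_int (k : ℕ) :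
    ∫ t in (0 : ℝ)..(π / 2), sin t ^ (2 * k) = π / 2 * ((2 * k).choose k) / 4 ^ k := by
  induction k with
  | zero => simp
  | succ k ih =>
    have h := integral_sin_pow (a := 0) (b := π / 2) (2 * k)
    rw [show 2 * (k + 1) = 2 * k + 2 by ring, h, ih]
    have h2 := Nat.succ_mul_centralBinom_succ k
    rw [Nat.centralBinom_eq_two_mul_choose, Nat.centralBinom_eq_two_mul_choose] at h2
    have h3 : ((k : ℝ) + 1) * ((2 * k + 2).choose (k + 1) : ℕ)
        = 2 * (2 * k + 1) * ((2 * k).choose k : ℕ) := by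
      exact_mod_cast h2
    have hk : (k : ℝ) + 1 ≠ 0 := by positivity
    have h4 : (((2 * k + 2).choose (k + 1) : ℕ) : ℝ)
        = 2 * (2 * k + 1) * ((2 * k).choose k : ℕ) / (k + 1) := by
      rw [← h3]; field_simp
    rw [h4]
    have hk2 : 2 * (k : ℝ) + 2 ≠ 0 := by positivity
    simp only [sin_zero, cos_pi_div_two, zero_mul, mul_zero, sub_zero, zero_div, zero_add, pow_succ]
    push_cast
    field_simp
    ring

lemma aux_image : (fun t : ℝ => 4 * sin t ^ 2) '' Set.Ioo 0 (π / 2) = Set.Ioo 0 4 := by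
  ext x
  constructor
  · rintro ⟨t, ⟨h0, h1⟩, rfl⟩
    have hs : 0 < sin t := sin_pos_of_pos_of_lt_pi h0 (by linarith [pi_pos])
    have hc : 0 < cos t := cos_pos_of_mem_Ioo ⟨by linarith, h1⟩
    have := sin_sq_add_cos_sq t
    constructor
    · positivity
    · show 4 * sin t ^ 2 < 4
      nlinarith
  · rintro ⟨h0, h1⟩
    have hp : 0 < √(x / 4) := Real.sqrt_pos.2 (by linarith)
    have hl : √(x / 4) < 1 := by
      rw [Real.sqrt_lt' one_pos]; linarith
    refine ⟨arcsin √(x / 4), ⟨arcsin_pos.2 hp, arcsin_lt_pi_div_two.2 hl⟩, ?_⟩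
    show 4 * sin (arcsin √(x / 4)) ^ 2 = x
    rw [sin_arcsin (by linarith) hl.le, Real.sq_sqrt (by linarith)]
    ring

theorem aux_subst (k : ℕ) :
    ∫ x in (0 : ℝ)..4, x ^ k * (1 / (2 * Real.pi) * Real.sqrt (4 / x - 1)) =
      ∫ t in (0 : ℝ)..(π / 2),
        4 ^ (k + 1) / π * (sin t ^ (2 * k) - sin t ^ (2 * (k + 1))) := by
  rw [intervalIntegral.integral_of_le (by norm_num),
    intervalIntegral.integral_of_le (by positivity), integral_Ioc_eq_integral_Ioo,
    integral_Ioc_eq_integral_Ioo, ← aux_image]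
  rw [integral_image_eq_integral_abs_deriv_smul (f' := fun t => 8 * sin t * cos t)
    measurableSet_Ioo]
  · refine setIntegral_congr_fun measurableSet_Ioo ?_
    rintro t ⟨h0, h1⟩
    have hs : 0 < sin t := sin_pos_of_pos_of_lt_pi h0 (by linarith [pi_pos])
    have hc : 0 < cos t := cos_pos_of_mem_Ioo ⟨by linarith, h1⟩
    have hq : √(4 / (4 * sin t ^ 2) - 1) = cos t / sin t := by
      rw [Real.sqrt_eq_iff_eq_sq _ (by positivity)]
      · rw [div_pow, cos_sq']; field_simp
      · have := sin_sq_le_one t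
        rw [sub_nonneg, one_le_div (by positivity)]; linarith
    simp only [smul_eq_mul]
    rw [hq, abs_of_pos (by positivity)]
    have e : sin t ^ (2 * k) - sin t ^ (2 * (k + 1)) = sin t ^ (2 * k) * cos t ^ 2 := by
      rw [cos_sq']; ring
    rw [e, mul_pow, ← pow_mul]
    field_simp
    ring
  · intro t _
    have := (((hasDerivAt_sin t).pow 2).const_mul 4).hasDerivWithinAt (s := Set.Ioo 0 (π / 2))
    refine this.congr_deriv ?_
    push_cast
    ring
  · intro a ha b hb h
    have hsa : 0 < sin a := sin_pos_of_pos_of_lt_pi ha.1 (by linarith [pi_pos, ha.2])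
    have hsb : 0 < sin b := sin_pos_of_pos_of_lt_pi hb.1 (by linarith [pi_pos, hb.2])
    have h' : sin a ^ 2 = sin b ^ 2 := by
      have : 4 * sin a ^ 2 = 4 * sin b ^ 2 := h
      linarith
    have h2 : sin a = sin b := (pow_left_inj₀ hsa.le hsb.le two_ne_zero).1 h'
    exact injOn_sin ⟨by linarith [ha.1, pi_pos], ha.2.le⟩ ⟨by linarith [hb.1, pi_pos], hb.2.le⟩ h2

/-- For every natural number `k`,
`∫_0^4 x^k · (1/(2π)) · √(4/x − 1) dx = (1/(k+1)) · binomial (2k) k`;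
the moments of the density `π₁(x) = (1/(2π))√(4x⁻¹ − 1)` on `(0,4]` are the Catalan numbers. -/
theorem moments_of_piOne_eq_catalan (k : ℕ) :
    ∫ x in (0 : ℝ)..4, x ^ k * (1 / (2 * Real.pi) * Real.sqrt (4 / x - 1)) =
      (1 / ((k : ℝ) + 1)) * ((2 * k).choose k) := by
  rw [aux_subst, intervalIntegral.integral_const_mul, intervalIntegral.integral_sub
    (Continuous.intervalIntegrable (by fun_prop) _ _)
    (Continuous.intervalIntegrable (by fun_prop) _ _), aux_sin_int, aux_sin_int]
  have h2 := Nat.succ_mul_centralBinom_succ k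
  rw [Nat.centralBinom_eq_two_mul_choose, Nat.centralBinom_eq_two_mul_choose] at h2
  have h3 : ((k : ℝ) + 1) * ((2 * (k + 1)).choose (k + 1) : ℕ)
      = 2 * (2 * k + 1) * ((2 * k).choose k : ℕ) := by
    exact_mod_cast h2
  have hk : (k : ℝ) + 1 ≠ 0 := by positivity
  have h4 : (((2 * (k + 1)).choose (k + 1) : ℕ) : ℝ)
      = 2 * (2 * k + 1) * ((2 * k).choose k : ℕ) / (k + 1) := by
    rw [← h3]; field_simp
  rw [h4, pow_succ]
  field_simp
  ring
end

section
/- For all integers s ≥ 1 and k ≥ 0, the Fuss–Catalan number admits the Pochhammer closed form: (1/(sk+1)) · binomial((s+1)k, k) = ((2k)!/k!) · (K/4)^k · ( ∏_{i=1}^{s} (i/(s+1))_k ) / ( (1/2)_k · ∏_{i=2}^{s+1} (i/s)_k ), where K = (s+1)^{s+1}/s^s. -/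
open Finset

/-- The rising factorial (Pochhammer symbol) `(a)_k = a(a+1)⋯(a+k−1)`, with `(a)_0 = 1`. -/
noncomputable def poch (a : ℝ) (k : ℕ) : ℝ := (ascPochhammer ℝ k).eval a

lemma prod_shift_factorial (m n : ℕ) :
    ((m.factorial : ℝ)) * ∏ i ∈ range n, ((m : ℝ) + 1 + i) = ((m + n).factorial : ℝ) := by
  induction n with
  | zero => simp
  | succ n ih =>
    rw [prod_range_succ, ← mul_assoc, ih, ← Nat.add_assoc, Nat.factorial_succ]
    push_cast
    ring

lemma poch_succ_right (a : ℝ) (k : ℕ) : poch a (k + 1) = poch a k * (a + k) := by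
  unfold poch
  rw [ascPochhammer_succ_eval]

lemma poch_pos_of_pos (a : ℝ) (ha : 0 < a) (k : ℕ) : 0 < poch a k :=
  ascPochhammer_pos k a ha

lemma gauss_mult (n : ℕ) (hn : 0 < n) (c k : ℕ) :
    (c.factorial : ℝ) * (((n : ℝ) ^ n) ^ k * ∏ i ∈ range n, poch (((c : ℝ) + 1 + i) / n) k)
      = ((c + n * k).factorial : ℝ) := by
  have hn' : (n : ℝ) ≠ 0 := by positivity
  induction k with
  | zero => simp [poch]
  | succ k ih =>
    have h2 : ∏ i ∈ range n, (((c + n * k : ℕ) : ℝ) + 1 + i)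
        = (n : ℝ) ^ n * ∏ i ∈ range n, (((c : ℝ) + 1 + i) / n + k) := by
      conv_rhs => rw [← card_range n, ← prod_const, card_range, ← prod_mul_distrib]
      apply prod_congr rfl
      intro i _
      push_cast
      field_simp
      ring
    simp_rw [poch_succ_right]
    rw [prod_mul_distrib, Nat.mul_succ, ← Nat.add_assoc, ← prod_shift_factorial, ← ih, h2]
    ring

/-- For all integers `s ≥ 1` and `k ≥ 0`, the Fuss–Catalan number admits the
Pochhammer closed form with `K = (s+1)^{s+1}/s^s`. -/
theorem fussCatalan_pochhammer_form (s : ℕ) (hs : 1 ≤ s) (k : ℕ) :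
    (1 / ((s : ℝ) * k + 1)) * (((s + 1) * k).choose k) =
      (((2 * k).factorial : ℝ) / (k.factorial : ℝ)) * (Kc s / 4) ^ k *
        (∏ i ∈ Finset.Icc 1 s, poch ((i : ℝ) / ((s : ℝ) + 1)) k) /
        (poch (1 / 2) k * ∏ i ∈ Finset.Icc 2 (s + 1), poch ((i : ℝ) / (s : ℝ)) k) := by
  have p1 : poch 1 k = k.factorial := by
    unfold poch
    simp
  have hs0 : (0 : ℝ) < s := by exact_mod_cast hs
  have e1 := gauss_mult (s + 1) (by omega) 0 k
  have e2 := gauss_mult 2 (by omega) 0 k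
  have e3 := gauss_mult s (by omega) 1 k
  have hP : ∏ i ∈ Finset.Icc 1 s, poch ((i : ℝ) / ((s : ℝ) + 1)) k
      = ∏ i ∈ range s, poch ((1 + (i : ℝ)) / ((s : ℝ) + 1)) k := by
    rw [← Finset.Ico_add_one_right_eq_Icc, prod_Ico_eq_prod_range]
    simp
  have hQ : ∏ i ∈ Finset.Icc 2 (s + 1), poch ((i : ℝ) / (s : ℝ)) k
      = ∏ i ∈ range s, poch ((1 + 1 + (i : ℝ)) / (s : ℝ)) k := by
    rw [← Finset.Ico_add_one_right_eq_Icc, prod_Ico_eq_prod_range]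
    rw [show s + 1 + 1 - 2 = s by omega]
    norm_num
  rw [hP, hQ]
  have hQ0 : 0 < ∏ i ∈ range s, poch ((1 + 1 + (i : ℝ)) / (s : ℝ)) k :=
    prod_pos fun i _ => poch_pos_of_pos _ (by positivity) k
  have hH0 : 0 < poch (1 / 2) k := poch_pos_of_pos _ (by positivity) k
  rw [prod_range_succ] at e1
  have hone : (((0 : ℕ) : ℝ) + 1 + s) / ((s + 1 : ℕ) : ℝ) = 1 := by
    push_cast
    field_simp
    ring
  rw [hone, p1] at e1
  simp only [prod_range_succ, prod_range_zero] at e2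
  norm_num [p1] at e1 e2 e3
  norm_num at hH0 ⊢
  have hch : (((s + 1) * k).choose k : ℝ) * k.factorial * (s * k).factorial
      = (((s + 1) * k).factorial : ℝ) := by
    have h := Nat.choose_mul_factorial_mul_factorial (n := (s + 1) * k) (k := k) (by nlinarith)
    rw [show (s + 1) * k - k = s * k by rw [Nat.succ_mul]; simp] at h
    exact_mod_cast h
  have e4 : ((1 + s * k).factorial : ℝ) = (s * k + 1) * (s * k).factorial := by
    rw [Nat.add_comm, Nat.factorial_succ]
    push_cast
    ring
  rw [e4] at e3
  rw [← hch] at e1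
  set P := ∏ i ∈ range s, poch ((1 + (i : ℝ)) / ((s : ℝ) + 1)) k
  set Q := ∏ i ∈ range s, poch ((2 + (i : ℝ)) / (s : ℝ)) k
  have hk : (k.factorial : ℝ) ≠ 0 := by positivity
  have hsk : ((s * k).factorial : ℝ) ≠ 0 := by positivity
  have h1 : (s : ℝ) * k + 1 ≠ 0 := by positivity
  have e1' : (((s : ℝ) + 1) ^ (s + 1)) ^ k * P
      = (((s + 1) * k).choose k : ℝ) * (s * k).factorial := by
    apply mul_right_cancel₀ hk
    linarith
  have hS : ((s : ℝ) ^ s) ^ k ≠ 0 := by positivity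
  rw [← e2, Kc, div_pow, div_pow]
  have hH1 := hH0.ne'
  have hQ1 : Q ≠ 0 := by
    intro h
    rw [h] at e3
    simp at e3
    rcases e3 with h | h
    · exact h1 h
    · exact hsk (by exact_mod_cast h)
  have : (((s + 1) * k).choose k : ℝ) / (s * k + 1)
      = ((((s : ℝ) + 1) ^ (s + 1)) ^ k * P) / (((s : ℝ) ^ s) ^ k * Q) := by
    rw [e1', e3]
    field_simp
  calc _ = (((s + 1) * k).choose k : ℝ) / (s * k + 1) := by rw [div_eq_inv_mul]
    _ = _ := by
      rw [this]
      field_simp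
end
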